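/- arXiv:1805.12481 — 2 statements merged into one kernel-verified Lean document; each statement's English description precedes it below -/
import Mathlib

section
/- Let p ≥ 1 and let h be a real polynomial of degree at most p+1 with Legendre expansion h = Σ_{i=0}^{p+1} h̃_i P_i. If h satisfies the GLSFR condition of order p, then the sum of h̃_i over all even indices i with 0 ≤ i ≤ p−1 equals 0 and the sum of h̃_i over all odd indices i with 0 ≤ i ≤ p−1 equals 0. -/
open Polynomial Finset

/-- The degree-`n` Legendre polynomial of the first kind on `[-1,1]`, defined by the
Rodrigues formula `P_n(x) = 1/(2^n n!) · dⁿ/dxⁿ (x² − 1)ⁿ`. -/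
noncomputable def legendre (n : ℕ) : Polynomial ℝ :=
  Polynomial.C ((1 : ℝ) / (2 ^ n * n.factorial)) *
    (Polynomial.derivative^[n] ((Polynomial.X ^ 2 - 1) ^ n))

/-- A real polynomial `h` satisfies the GLSFR condition of order `p` if
`∫_{-1}^{1} h(ξ) u'(ξ) dξ = 0` for every real polynomial `u` of degree at most `p`. -/
def GLSFRCondition (p : ℕ) (h : Polynomial ℝ) : Prop :=
  ∀ u : Polynomial ℝ, u.natDegree ≤ p →
    (∫ ξ in (-1:ℝ)..1, h.eval ξ * ((Polynomial.derivative u).eval ξ)) = 0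

lemma eval_iterate_derivative_sq_sub_one_pow {n j : ℕ} (hj : j < n) {a : ℝ} (ha : a ^ 2 = 1) :
    (derivative^[j] ((X ^ 2 - 1 : ℝ[X]) ^ n)).eval a = 0 := by
  have hdvd : (X ^ 2 - 1 : ℝ[X]) ∣ derivative^[j] ((X ^ 2 - 1 : ℝ[X]) ^ n) :=
    (dvd_pow_self _ (Nat.sub_ne_zero_of_lt hj)).trans
      (pow_sub_dvd_iterate_derivative_of_pow_dvd j dvd_rfl)
  obtain ⟨r, hr⟩ := hdvd
  simp [hr, ha]

lemma integral_iterate_derivative_mul_eq_zero {n j : ℕ} (hj : j ≤ n) {q : ℝ[X]}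
    (hq : derivative^[j] q = 0) :
    (∫ x in (-1:ℝ)..1, (derivative^[j] ((X ^ 2 - 1 : ℝ[X]) ^ n)).eval x * q.eval x) = 0 := by
  induction j generalizing q with
  | zero =>
    rw [Function.iterate_zero_apply] at hq
    simp [hq]
  | succ j ih =>
    set f := derivative^[j] ((X ^ 2 - 1 : ℝ[X]) ^ n) with hf
    have hparts := intervalIntegral.integral_mul_deriv_eq_deriv_mul (a := -1) (b := 1)
      (fun x _ => q.hasDerivAt x) (fun x _ => f.hasDerivAt x)
      ((derivative q).continuous.intervalIntegrable _ _)
      ((derivative f).continuous.intervalIntegrable _ _)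
    have hind := ih (Nat.le_of_succ_le hj) (q := derivative q) hq
    rw [Function.iterate_succ_apply', ← hf]
    simp_rw [mul_comm (eval _ (derivative f))]
    simp_rw [mul_comm (eval _ f)] at hind
    rw [hparts, hind, hf, eval_iterate_derivative_sq_sub_one_pow hj (by norm_num),
      eval_iterate_derivative_sq_sub_one_pow hj (by norm_num)]
    simp

lemma integral_legendre_mul_eq_zero {n : ℕ} {q : ℝ[X]} (hq : q.natDegree < n) :
    (∫ x in (-1:ℝ)..1, (legendre n).eval x * q.eval x) = 0 := by
  simp only [legendre, eval_mul, eval_C, mul_assoc, intervalIntegral.integral_const_mul]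
  rw [integral_iterate_derivative_mul_eq_zero le_rfl (iterate_derivative_eq_zero hq), mul_zero]

lemma natDegree_sq_sub_one_pow (n : ℕ) : ((X ^ 2 - 1 : ℝ[X]) ^ n).natDegree = 2 * n := by
  rw [natDegree_pow, ← C_1, natDegree_X_pow_sub_C, mul_comm]

lemma natDegree_legendre_le (n : ℕ) : (legendre n).natDegree ≤ n := by
  refine (natDegree_C_mul_le _ _).trans ((natDegree_iterate_derivative _ _).trans ?_)
  rw [natDegree_sq_sub_one_pow]
  omega

lemma legendre_ne_zero (n : ℕ) : legendre n ≠ 0 := by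
  refine mul_ne_zero (C_ne_zero.2 (by positivity)) fun h0 => ?_
  have hmonic : ((X ^ 2 - 1 : ℝ[X]) ^ n).Monic := by
    rw [← C_1]
    exact (monic_X_pow_sub_C 1 two_ne_zero).pow n
  have hc := congrArg (fun f => f.coeff n) h0
  simp only [coeff_iterate_derivative, coeff_zero, ← two_mul] at hc
  rw [← natDegree_sq_sub_one_pow n, hmonic.coeff_natDegree, natDegree_sq_sub_one_pow,
    nsmul_one, Nat.cast_eq_zero, Nat.descFactorial_eq_zero_iff_lt] at hc
  omega

lemma integral_legendre_mul_legendre {i k : ℕ} (hik : i ≠ k) :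
    (∫ x in (-1:ℝ)..1, (legendre i).eval x * (legendre k).eval x) = 0 := by
  rcases hik.lt_or_gt with hlt | hgt
  · simp_rw [mul_comm (eval _ (legendre i))]
    exact integral_legendre_mul_eq_zero ((natDegree_legendre_le i).trans_lt hlt)
  · exact integral_legendre_mul_eq_zero ((natDegree_legendre_le k).trans_lt hgt)

lemma integral_mul_self_eval_pos {q : ℝ[X]} (hq : q ≠ 0) :
    0 < ∫ x in (-1:ℝ)..1, q.eval x * q.eval x := by
  obtain ⟨c, hc, hqc⟩ : ∃ c ∈ Set.Icc (-1:ℝ) 1, q.eval c ≠ 0 := by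
    by_contra! hzero
    exact hq (eq_zero_of_infinite_isRoot q
      ((Set.Icc_infinite (by norm_num : (-1:ℝ) < 1)).mono hzero))
  exact intervalIntegral.integral_pos (by norm_num)
    (q.continuous.mul q.continuous).continuousOn (fun x _ => mul_self_nonneg _)
    ⟨c, hc, mul_self_pos.2 hqc⟩

lemma exists_derivative_eq_legendre (k : ℕ) :
    ∃ u : ℝ[X], u.natDegree ≤ k + 1 ∧ derivative u = legendre k := by
  cases k with
  | zero => exact ⟨X, natDegree_X_le, by simp [legendre]⟩
  | succ k =>
    refine ⟨C ((1 : ℝ) / (2 ^ (k + 1) * (k + 1).factorial)) *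
      derivative^[k] ((X ^ 2 - 1) ^ (k + 1)), ?_, ?_⟩
    · refine (natDegree_C_mul_le _ _).trans ((natDegree_iterate_derivative _ _).trans ?_)
      rw [natDegree_sq_sub_one_pow]
      omega
    · rw [derivative_C_mul, ← Function.iterate_succ_apply' derivative, legendre]

lemma GLSFRCondition.coeff_eq_zero {p N : ℕ} {a : ℕ → ℝ}
    (h : GLSFRCondition p (∑ i ∈ range N, C (a i) * legendre i)) {k : ℕ} (hkp : k < p)
    (hkN : k < N) : a k = 0 := by
  obtain ⟨u, hdeg, hu⟩ := exists_derivative_eq_legendre k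
  have hint := h u (hdeg.trans hkp)
  simp only [hu, eval_finsetSum, eval_mul, eval_C, sum_mul, mul_assoc] at hint
  rw [intervalIntegral.integral_finsetSum fun i _ =>
    (by fun_prop : Continuous fun x =>
      a i * ((legendre i).eval x * (legendre k).eval x)).intervalIntegrable _ _] at hint
  simp only [intervalIntegral.integral_const_mul] at hint
  rw [sum_eq_single_of_mem k (mem_range.2 hkN) fun i _ hik => by
    rw [integral_legendre_mul_legendre hik, mul_zero]] at hint
  exact (mul_eq_zero.1 hint).resolve_right (integral_mul_self_eval_pos (legendre_ne_zero k)).ne'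

theorem glsfr_even_odd_sums (p : ℕ) (hp : 1 ≤ p) (ht : ℕ → ℝ) (h : Polynomial ℝ)
    (hh : h = ∑ i ∈ Finset.range (p + 2), Polynomial.C (ht i) * legendre i)
    (hstab : GLSFRCondition p h) :
    (∑ i ∈ (Finset.range p).filter (fun i => Even i), ht i) = 0 ∧
    (∑ i ∈ (Finset.range p).filter (fun i => Odd i), ht i) = 0 := by
  subst hh
  have hzero : ∀ i ∈ range p, ht i = 0 := fun i hi =>
    hstab.coeff_eq_zero (mem_range.1 hi) (by have := mem_range.1 hi; omega)
  exact ⟨sum_eq_zero fun i hi => hzero i (mem_of_mem_filter i hi),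
    sum_eq_zero fun i hi => hzero i (mem_of_mem_filter i hi)⟩
end

section
/- Let p ≥ 1 and let h be a real polynomial of degree at most p+1 with Legendre expansion h = Σ_{i=0}^{p+1} h̃_i P_i such that h(−1) = 1, h(1) = 0, the sum of h̃_i over all even indices i with 0 ≤ i ≤ p−1 equals 0, and the sum of h̃_i over all odd indices i with 0 ≤ i ≤ p−1 equals 0. Then h̃_p = (−1)^p/2 and h̃_{p+1} = (−1)^{p+1}/2. -/
open Polynomial Finset

/-- The `n`-th derivative at `a` of a polynomial divisible by `(X - a) ^ n`. -/
lemma eval_iterate_derivative_X_sub_C_pow_mul {R : Type*} [CommRing R] (a : R) (n : ℕ)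
    (q : Polynomial R) :
    (derivative^[n] ((X - C a) ^ n * q)).eval a = n.factorial * q.eval a := by
  have key : (hasseDeriv n ((X - C a) ^ n * q)).eval a = q.eval a := by
    rw [← taylor_coeff, taylor_mul, taylor_pow]
    have hX : taylor a (X - C a) = X := by simp
    rw [hX, coeff_X_pow_mul', if_pos le_rfl, Nat.sub_self, taylor_coeff_zero]
  rw [← factorial_smul_hasseDeriv]
  simp [key]

lemma legendre_eval_one (n : ℕ) : (legendre n).eval 1 = 1 := by
  have hf : (X ^ 2 - 1 : Polynomial ℝ) ^ n = (X - C 1) ^ n * (X + 1) ^ n := by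
    rw [← mul_pow, C_1]
    ring
  rw [legendre, hf, eval_mul, eval_iterate_derivative_X_sub_C_pow_mul]
  have := n.factorial_ne_zero
  simp only [eval_C, eval_pow, eval_add, eval_X, eval_one]
  norm_num
  field_simp

lemma legendre_eval_neg_one (n : ℕ) : (legendre n).eval (-1) = (-1) ^ n := by
  have hf : (X ^ 2 - 1 : Polynomial ℝ) ^ n = (X - C (-1)) ^ n * (X - 1) ^ n := by
    rw [← mul_pow, C_neg, C_1]
    ring
  rw [legendre, hf, eval_mul, eval_iterate_derivative_X_sub_C_pow_mul]
  have := n.factorial_ne_zero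
  have h2 : (-1 - 1 : ℝ) ^ n = (-1) ^ n * 2 ^ n := by
    rw [← mul_pow]
    norm_num
  simp only [eval_C, eval_pow, eval_sub, eval_X, eval_one, h2]
  field_simp

theorem glsfr_left_top_coefficients (p : ℕ) (hp : 1 ≤ p) (ht : ℕ → ℝ) (h : Polynomial ℝ)
    (hh : h = ∑ i ∈ Finset.range (p + 2), Polynomial.C (ht i) * legendre i)
    (hbcL : h.eval (-1 : ℝ) = 1) (hbcR : h.eval (1 : ℝ) = 0)
    (heven : (∑ i ∈ (Finset.range p).filter (fun i => Even i), ht i) = 0)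
    (hodd : (∑ i ∈ (Finset.range p).filter (fun i => Odd i), ht i) = 0) :
    ht p = (-1 : ℝ) ^ p / 2 ∧ ht (p + 1) = (-1 : ℝ) ^ (p + 1) / 2 := by
  rw [Finset.sum_filter] at heven hodd
  have hsum : ∑ i ∈ Finset.range p, ht i = 0 := by
    refine Eq.trans ?_ ((congrArg₂ (· + ·) heven hodd).trans (add_zero 0))
    rw [← Finset.sum_add_distrib]
    refine Finset.sum_congr rfl fun i _ => ?_
    rcases Nat.even_or_odd i with hi | hi
    · simp [hi, Nat.not_odd_iff_even.2 hi]
    · simp [hi, Nat.not_even_iff_odd.2 hi]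
  have halt : ∑ i ∈ Finset.range p, ht i * (-1) ^ i = 0 := by
    refine Eq.trans ?_ ((congrArg₂ (· - ·) heven hodd).trans (sub_zero 0))
    rw [← Finset.sum_sub_distrib]
    refine Finset.sum_congr rfl fun i _ => ?_
    rcases Nat.even_or_odd i with hi | hi
    · simp [hi, Nat.not_odd_iff_even.2 hi]
    · simp [hi, Nat.not_even_iff_odd.2 hi]
  simp only [hh, eval_add, eval_finsetSum, eval_mul, eval_C, legendre_eval_one, legendre_eval_neg_one,
    mul_one, Finset.sum_range_succ, hsum, halt, zero_add] at hbcL hbcR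
  rw [pow_succ] at hbcL ⊢
  rcases neg_one_pow_eq_or ℝ p with hs | hs <;> rw [hs] at hbcL ⊢ <;>
    constructor <;> linarith
end
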